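/- The ideal class group of the ring of integers of the real quadratic field ℚ(√91) is isomorphic to ℤ/2ℤ, and the ideal class group of the ring of integers of the imaginary quadratic field ℚ(√-91) is also isomorphic to ℤ/2ℤ. -/

import Mathlib

open NumberField IntermediateField Polynomial

/-- `√n` is integral over `ℚ`. -/
theorem sqrtNat_isIntegral (n : ℕ) : IsIntegral ℚ (Real.sqrt n) := by
  refine ⟨X ^ 2 - C (n : ℚ), by monicity!, ?_⟩
  simp [Real.sq_sqrt (by positivity : (0:ℝ) ≤ (n:ℝ))]

/-- `√(-n) = √n · i` is integral over `ℚ`. -/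
theorem sqrtNegNat_isIntegral (n : ℕ) :
    IsIntegral ℚ ((Real.sqrt n : ℂ) * Complex.I) := by
  refine ⟨X ^ 2 + C (n : ℚ), by monicity!, ?_⟩
  have h : ((Real.sqrt n : ℝ) : ℂ) ^ 2 = (n : ℂ) := by
    rw [← Complex.ofReal_pow, Real.sq_sqrt (by positivity : (0:ℝ) ≤ (n:ℝ))]
    simp
  simp [mul_pow, Complex.I_sq, h]

/-- The real quadratic field `ℚ(√n)` is a number field. -/
instance (n : ℕ) : NumberField ℚ⟮Real.sqrt n⟯ :=
  { to_charZero := inferInstance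
    to_finiteDimensional := IntermediateField.adjoin.finiteDimensional (sqrtNat_isIntegral n) }

/-- The imaginary quadratic field `ℚ(√-n)` is a number field. -/
instance (n : ℕ) : NumberField ℚ⟮(Real.sqrt n : ℂ) * Complex.I⟯ :=
  { to_charZero := inferInstance
    to_finiteDimensional :=
      IntermediateField.adjoin.finiteDimensional (sqrtNegNat_isIntegral n) }

section QuadraticGenerator

/-- `1, ω` is a basis of the `S`-algebra `A`, and `ω` is a root of `X ^ 2 - t X + n`. -/
structure IsQuadraticGenerator {S A : Type*} [CommRing S] [CommRing A] [Algebra S A]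
    (ω : A) (t n : S) : Prop where
  sq : ω ^ 2 = algebraMap S A t * ω - algebraMap S A n
  exists_eq : ∀ x : A, ∃ a b : S, x = algebraMap S A a + algebraMap S A b * ω
  indep : ∀ a b : S, algebraMap S A a + algebraMap S A b * ω = 0 → a = 0 ∧ b = 0

namespace IsQuadraticGenerator

section General

variable {S A : Type*} [CommRing S] [CommRing A] [Algebra S A] {ω : A} {t n : S}

/-- The basis `1, ω`. -/
noncomputable def basis (h : IsQuadraticGenerator ω t n) : Module.Basis (Fin 2) S A :=
  Module.Basis.mk (v := ![1, ω])
    (by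
      rw [LinearIndependent.pair_iff]
      intro a b hab
      exact h.indep a b (by simpa [Algebra.smul_def] using hab))
    (by
      rintro x -
      obtain ⟨a, b, rfl⟩ := h.exists_eq x
      rw [Matrix.range_cons_cons_empty, Submodule.mem_span_pair]
      exact ⟨a, b, by simp [Algebra.smul_def]⟩)

theorem basis_zero (h : IsQuadraticGenerator ω t n) : h.basis 0 = 1 := by simp [basis]

theorem basis_one (h : IsQuadraticGenerator ω t n) : h.basis 1 = ω := by simp [basis]

theorem finrank_eq [Nontrivial S] (h : IsQuadraticGenerator ω t n) : Module.finrank S A = 2 := by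
  simp [Module.finrank_eq_card_basis h.basis]

theorem trace_one (h : IsQuadraticGenerator ω t n) : Algebra.trace S A 1 = 2 := by
  rw [Algebra.trace_eq_matrix_trace h.basis]
  simp

theorem trace_self (h : IsQuadraticGenerator ω t n) : Algebra.trace S A ω = t := by
  have h2 : ω * ω = t • h.basis 1 - n • h.basis 0 := by
    rw [h.basis_zero, h.basis_one, ← pow_two, h.sq]
    simp [Algebra.smul_def]
  have h1 : ω * h.basis 0 = h.basis 1 := by rw [h.basis_zero, h.basis_one, mul_one]
  rw [Algebra.trace_eq_matrix_trace h.basis, Matrix.trace_fin_two,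
    Algebra.leftMulMatrix_eq_repr_mul, Algebra.leftMulMatrix_eq_repr_mul, h1]
  nth_rewrite 2 [h.basis_one]
  rw [h2]
  simp

theorem trace_eq (h : IsQuadraticGenerator ω t n) (a b : S) :
    Algebra.trace S A (algebraMap S A a + algebraMap S A b * ω) = 2 * a + b * t := by
  rw [← Algebra.smul_def, Algebra.algebraMap_eq_smul_one, map_add, map_smul, map_smul,
    h.trace_one, h.trace_self]
  simp [mul_comm]

theorem discr_basis (h : IsQuadraticGenerator ω t n) :
    Algebra.discr S h.basis = t ^ 2 - 4 * n := by
  have h2 : Algebra.trace S A (ω * ω) = t ^ 2 - 2 * n := by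
    have := h.trace_eq (-n) t
    rw [← pow_two, h.sq, sub_eq_neg_add, ← map_neg, this]
    ring
  rw [Algebra.discr_def, Matrix.det_fin_two]
  simp only [Algebra.traceMatrix_apply, Algebra.traceForm_apply, h.basis_zero, h.basis_one,
    mul_one, one_mul, h.trace_one, h.trace_self, h2]
  ring

end General

section Int

variable {R : Type*} [CommRing R] {ω : R} {t n : ℤ}

theorem int_sq (h : IsQuadraticGenerator ω t n) : ω ^ 2 = t * ω - n := by simpa using h.sq

theorem int_exists_eq (h : IsQuadraticGenerator ω t n) (x : R) :
    ∃ a b : ℤ, x = a + b * ω := by simpa using h.exists_eq x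

theorem int_ext (h : IsQuadraticGenerator ω t n) {a b c d : ℤ}
    (hab : (a : R) + b * ω = c + d * ω) : a = c ∧ b = d := by
  have := h.indep (a - c) (b - d) (by
    simp only [algebraMap_int_eq, eq_intCast, Int.cast_sub]
    linear_combination hab)
  omega

theorem normForm_dvd (h : IsQuadraticGenerator ω t n) {a b c d : ℤ}
    (hdvd : (a : R) + b * ω ∣ c + d * ω) :
    a ^ 2 + t * a * b + n * b ^ 2 ∣ c ^ 2 + t * c * d + n * d ^ 2 := by
  obtain ⟨y, hy⟩ := hdvd
  obtain ⟨u, v, rfl⟩ := h.int_exists_eq y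
  obtain ⟨rfl, rfl⟩ := h.int_ext (c := a * u - n * b * v) (d := a * v + b * u + t * b * v)
    (hy.trans (by push_cast; linear_combination (b * v : R) * h.int_sq))
  exact ⟨u ^ 2 + t * u * v + n * v ^ 2, by ring⟩

theorem dvd_normForm (h : IsQuadraticGenerator ω t n) {p a e f : ℤ}
    (hp : p ∣ a ^ 2 - t * a + n)
    (hmem : (e : R) + f * ω ∈ Ideal.span {(p : R), ω - a}) :
    p ∣ e ^ 2 + t * e * f + n * f ^ 2 := by
  obtain ⟨x, y, hxy⟩ := Ideal.mem_span_pair.mp hmem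
  obtain ⟨u, v, rfl⟩ := h.int_exists_eq x
  obtain ⟨r, s, rfl⟩ := h.int_exists_eq y
  obtain ⟨rfl, rfl⟩ := h.int_ext (c := u * p - r * a - n * s)
    (d := v * p + r + t * s - a * s)
    (hxy.symm.trans (by push_cast; linear_combination (s : R) * h.int_sq))
  obtain ⟨k, hk⟩ := hp
  set e := u * p - r * a - n * s
  set f := v * p + r + t * s - a * s
  refine ⟨(u + v * a - s * k) * (e + (t - a) * f) + f ^ 2 * k, ?_⟩
  linear_combination (f ^ 2 - s * (e + (t - a) * f)) * hk

theorem prime_dvd_of_intCast_mem {P : Ideal R} (hP : P.IsPrime) {p : ℕ} (hp : p.Prime)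
    (hpP : (p : R) ∈ P) {m : ℤ} (hm : (m : R) ∈ P) : (p : ℤ) ∣ m := by
  by_contra hdvd
  obtain ⟨u, v, huv⟩ := ((Nat.prime_iff_prime_int.mp hp).coprime_iff_not_dvd).mpr hdvd
  refine hP.one_notMem ?_
  have h1 : (u : R) * p + v * m = 1 := by exact_mod_cast congrArg (Int.cast : ℤ → R) huv
  rw [← h1]
  exact P.add_mem (P.mul_mem_left _ hpP) (P.mul_mem_left _ hm)

/-- The primes above `p` in a quadratic ring. -/
theorem prime_eq (h : IsQuadraticGenerator ω t n) {P : Ideal R} (hP : P.IsPrime) {p : ℕ}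
    (hp : p.Prime) (hpP : (p : R) ∈ P) :
    P = Ideal.span {(p : R)} ∨
      ∃ a : ℕ, a < p ∧ (p : ℤ) ∣ a ^ 2 - t * a + n ∧ P = Ideal.span {(p : R), ω - a} := by
  by_cases hex : ∃ a : ℤ, ω - a ∈ P
  · right
    obtain ⟨a, ha⟩ := hex
    have hp0 : (p : ℤ) ≠ 0 := by exact_mod_cast hp.ne_zero
    obtain ⟨b, hb⟩ := Int.eq_ofNat_of_zero_le (Int.emod_nonneg a hp0)
    have hbp : b < p := by
      have := Int.emod_lt_of_pos a (by exact_mod_cast hp.pos : (0 : ℤ) < p)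
      omega
    have hbP : ω - b ∈ P := by
      have hab : (a : R) = p * (a / p : ℤ) + b := by
        have := Int.mul_ediv_add_emod a p
        rw [hb] at this
        exact_mod_cast congrArg (Int.cast : ℤ → R) this.symm
      have : ω - b = ω - a + (a / p : ℤ) * p := by rw [hab]; ring
      rw [this]
      exact P.add_mem ha (P.mul_mem_left _ hpP)
    refine ⟨b, hbp, prime_dvd_of_intCast_mem hP hp hpP ?_, le_antisymm ?_ ?_⟩
    · have : (((b : ℤ) ^ 2 - t * b + n : ℤ) : R) = (t - b - ω) * (ω - b) := by
        push_cast
        linear_combination h.int_sq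
      rw [this]
      exact P.mul_mem_left _ hbP
    · intro x hx
      obtain ⟨u, v, rfl⟩ := h.int_exists_eq x
      obtain ⟨k, hk⟩ := prime_dvd_of_intCast_mem hP hp hpP (m := u + v * b) (by
        have : ((u + v * b : ℤ) : R) = u + v * ω - v * (ω - b) := by push_cast; ring
        rw [this]
        exact P.sub_mem hx (P.mul_mem_left _ hbP))
      have hk' : (u + v * b : R) = p * k := by exact_mod_cast congrArg (Int.cast : ℤ → R) hk
      exact Ideal.mem_span_pair.mpr ⟨k, v, by linear_combination -hk'⟩
    · rw [Ideal.span_le]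
      rintro x (rfl | rfl)
      exacts [hpP, hbP]
  · left
    refine le_antisymm (fun x hx ↦ ?_) (by rwa [Ideal.span_singleton_le_iff_mem])
    obtain ⟨u, v, rfl⟩ := h.int_exists_eq x
    have hv : (p : ℤ) ∣ v := by
      by_contra hdvd
      obtain ⟨r, s, hrs⟩ := ((Nat.prime_iff_prime_int.mp hp).coprime_iff_not_dvd).mpr hdvd
      refine hex ⟨-(s * u), ?_⟩
      have h1 : (r : R) * p + s * v = 1 := by exact_mod_cast congrArg (Int.cast : ℤ → R) hrs
      have : ω - ((-(s * u) : ℤ) : R) = s * (u + v * ω) + (r * ω) * p := by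
        push_cast
        linear_combination -ω * h1
      rw [this]
      exact P.add_mem (P.mul_mem_left _ hx) (P.mul_mem_left _ hpP)
    obtain ⟨k, rfl⟩ := hv
    have hu : (p : ℤ) ∣ u := prime_dvd_of_intCast_mem hP hp hpP (by
      have : (u : R) = u + ((p * k : ℤ) : R) * ω - k * ω * p := by push_cast; ring
      rw [this]
      exact P.sub_mem hx (P.mul_mem_left _ hpP))
    obtain ⟨l, rfl⟩ := hu
    exact Ideal.mem_span_singleton.mpr ⟨l + k * ω, by push_cast; ring⟩

end Int

end IsQuadraticGenerator

end QuadraticGenerator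

theorem Ideal.span_pair_eq_span_singleton {R : Type*} [CommRing R] {a b z : R}
    (ha : z ∣ a) (hb : z ∣ b) (hz : ∃ u v, u * a + v * b = z) :
    Ideal.span {a, b} = Ideal.span {z} := by
  apply le_antisymm
  · rw [Ideal.span_le]
    rintro x (rfl | rfl)
    exacts [Ideal.mem_span_singleton.mpr ha, Ideal.mem_span_singleton.mpr hb]
  · rwa [Ideal.span_singleton_le_iff_mem, Ideal.mem_span_pair]

theorem Ideal.span_pair_mul_span_pair_eq_span_singleton {R : Type*} [CommRing R]
    {a b c d z : R} (hac : z ∣ a * c) (had : z ∣ a * d) (hbc : z ∣ b * c) (hbd : z ∣ b * d)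
    (hz : ∃ r s u v, r * (a * c) + s * (a * d) + u * (b * c) + v * (b * d) = z) :
    Ideal.span {a, b} * Ideal.span {c, d} = Ideal.span {z} := by
  rw [Ideal.span_pair_mul_span_pair]
  apply le_antisymm
  · rw [Ideal.span_le]
    rintro x (rfl | rfl | rfl | rfl) <;> rwa [SetLike.mem_coe, Ideal.mem_span_singleton]
  · rw [Ideal.span_singleton_le_iff_mem]
    obtain ⟨r, s, u, v, rfl⟩ := hz
    refine add_mem (add_mem (add_mem ?_ ?_) ?_) ?_ <;>
      exact Ideal.mul_mem_left _ _ (Ideal.subset_span (by simp))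

theorem Ideal.IsPrime.exists_prime_natCast_mem {R : Type*} [CommRing R] {P : Ideal R}
    (hP : P.IsPrime) {m : ℕ} (hm0 : m ≠ 0) (hm : (m : R) ∈ P) :
    ∃ p : ℕ, p.Prime ∧ p ≤ m ∧ (p : R) ∈ P := by
  induction m using Nat.strong_induction_on with
  | _ m ih =>
    have hm1 : m ≠ 1 := by
      rintro rfl
      exact hP.one_notMem (by simpa using hm)
    have hp := Nat.minFac_prime hm1
    obtain ⟨k, hk⟩ := Nat.minFac_dvd m
    rcases hP.mem_or_mem (x := (m.minFac : R)) (y := k)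
      (by rw [← Nat.cast_mul, ← hk]; exact hm) with h | h
    · exact ⟨_, hp, Nat.minFac_le (by omega), h⟩
    · have hk0 : k ≠ 0 := by
        rintro rfl
        omega
      have hkm : k < m := by
        rw [hk]
        exact lt_mul_of_one_lt_left (by omega) hp.one_lt
      obtain ⟨p, hp, hpk, hpP⟩ := ih k hkm hk0 h
      exact ⟨p, hp, by omega, hpP⟩

section ClassGroupOrderTwo

open scoped nonZeroDivisors

variable {K : Type*} [Field K] [NumberField K]

theorem ClassGroup.nonempty_mulEquiv_zmod_two {Q : Ideal (𝓞 K)} (hQ0 : Q ≠ ⊥)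
    (hQ : ¬ Submodule.IsPrincipal Q) (hQQ : Submodule.IsPrincipal (Q * Q)) (B : ℕ)
    (hB : (4 / Real.pi) ^ InfinitePlace.nrComplexPlaces K *
      ((Module.finrank ℚ K).factorial / (Module.finrank ℚ K) ^ (Module.finrank ℚ K) *
        √|(discr K : ℝ)|) < B + 1)
    (h : ∀ (P : Ideal (𝓞 K)) (p : ℕ), P.IsPrime → p.Prime → p ≤ B → (p : 𝓞 K) ∈ P →
      Submodule.IsPrincipal P ∨ Submodule.IsPrincipal (P * Q)) :
    Nonempty (ClassGroup (𝓞 K) ≃* Multiplicative (ZMod 2)) := by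
  have hQm : Q ∈ (Ideal (𝓞 K))⁰ := mem_nonZeroDivisors_of_ne_zero hQ0
  set g := ClassGroup.mk0 ⟨Q, hQm⟩ with hg
  have hg1 : g ≠ 1 := fun h1 ↦ hQ ((ClassGroup.mk0_eq_one_iff hQm).mp h1)
  have hgg : g * g = 1 := by
    rw [hg, ← map_mul]
    exact (ClassGroup.mk0_eq_one_iff (mul_mem hQm hQm)).mpr hQQ
  let H : Subgroup (ClassGroup (𝓞 K)) := Subgroup.zpowers g
  have hmem : ∀ C : ClassGroup (𝓞 K), C ∈ H := by
    intro C
    obtain ⟨⟨I, hI⟩, rfl, hIM⟩ := exists_ideal_in_class_of_norm_le C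
    have hIB : Ideal.absNorm I ≤ B := by
      have : (Ideal.absNorm I : ℝ) < B + 1 := hIM.trans_lt hB
      exact Nat.lt_succ_iff.mp (by exact_mod_cast this)
    clear hB hIM
    induction I using UniqueFactorizationMonoid.induction_on_prime with
    | h₁ => exact absurd rfl (nonZeroDivisors.ne_zero hI)
    | h₂ x hx =>
      have : ClassGroup.mk0 ⟨x, hI⟩ = 1 := by
        rw [ClassGroup.mk0_eq_one_iff, Ideal.isUnit_iff.mp hx]
        exact top_isPrincipal
      rw [this]
      exact H.one_mem
    | h₃ J P hJ0 hP ih =>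
      have hJ : J ∈ (Ideal (𝓞 K))⁰ := mem_nonZeroDivisors_of_ne_zero hJ0
      have hPm : P ∈ (Ideal (𝓞 K))⁰ := mem_nonZeroDivisors_of_ne_zero hP.ne_zero
      have hmul : ClassGroup.mk0 ⟨P * J, hI⟩ = ClassGroup.mk0 ⟨P, hPm⟩ * ClassGroup.mk0 ⟨J, hJ⟩ := by
        rw [← map_mul]; rfl
      have hP0 : Ideal.absNorm P ≠ 0 := Ideal.absNorm_ne_zero_of_nonZeroDivisors ⟨P, hPm⟩
      have hJn : Ideal.absNorm J ≠ 0 := Ideal.absNorm_ne_zero_of_nonZeroDivisors ⟨J, hJ⟩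
      rw [map_mul] at hIB
      rw [hmul]
      refine H.mul_mem ?_ (ih hJ ((Nat.le_mul_of_pos_left _ (Nat.pos_of_ne_zero hP0)).trans hIB))
      have hPp := Ideal.isPrime_of_prime hP
      obtain ⟨p, hp, hpP, hmem⟩ := hPp.exists_prime_natCast_mem hP0 (Ideal.absNorm_mem P)
      have hPB := (Nat.le_mul_of_pos_right (Ideal.absNorm P) (Nat.pos_of_ne_zero hJn)).trans hIB
      rcases h P p hPp hp (hpP.trans hPB) hmem with h | h
      · rw [(ClassGroup.mk0_eq_one_iff hPm).mpr h]
        exact H.one_mem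
      · have : ClassGroup.mk0 ⟨P, hPm⟩ * g = 1 := by
          rw [hg, ← map_mul]
          exact (ClassGroup.mk0_eq_one_iff (mul_mem hPm hQm)).mpr h
        rw [eq_inv_of_mul_eq_one_left this]
        exact H.inv_mem (Subgroup.mem_zpowers g)
  have hord : orderOf g = 2 := orderOf_eq_prime (by rw [pow_two, hgg]) hg1
  have hcard : Nat.card (ClassGroup (𝓞 K)) = 2 := by
    rw [← hord, ← Nat.card_zpowers, ← Subgroup.card_top,
      (Subgroup.eq_top_iff' (Subgroup.zpowers g)).mpr hmem]
  exact ⟨mulEquivOfPrimeCardEq (p := 2) hcard (by simp)⟩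

end ClassGroupOrderTwo

section QuadraticField

/-- A square root of a rational number which is not a square generates a quadratic field. -/
theorem IntermediateField.isQuadraticGenerator_gen {L : Type*} [Field L] [Algebra ℚ L] {α : L}
    {d : ℚ} (hα : α ^ 2 = algebraMap ℚ L d) (hd : ∀ q : ℚ, q ^ 2 ≠ d) :
    IsQuadraticGenerator (AdjoinSimple.gen ℚ α) (0 : ℚ) (-d) where
  sq := by
    apply Subtype.ext
    simpa using hα
  exists_eq x := by
    have integral : IsIntegral ℚ α := by
      refine ⟨X ^ 2 - C d, by monicity!, ?_⟩
      simp [hα]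
    obtain ⟨x, hx⟩ := x
    have hx' : x ∈ Algebra.adjoin ℚ {α} := by
      rwa [← adjoin_simple_toSubalgebra_of_isAlgebraic integral.isAlgebraic]
    suffices ∃ a b : ℚ, x = algebraMap ℚ L a + algebraMap ℚ L b * α by
      obtain ⟨a, b, h⟩ := this
      exact ⟨a, b, Subtype.ext (by simpa using h)⟩
    clear hx
    induction hx' using Algebra.adjoin_induction with
    | mem x hx => exact ⟨0, 1, by simpa using hx⟩
    | algebraMap r => exact ⟨r, 0, by simp⟩
    | add x y _ _ hx hy =>
      obtain ⟨a, b, rfl⟩ := hx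
      obtain ⟨u, v, rfl⟩ := hy
      exact ⟨a + u, b + v, by simp only [map_add]; ring⟩
    | mul x y _ _ hx hy =>
      obtain ⟨a, b, rfl⟩ := hx
      obtain ⟨u, v, rfl⟩ := hy
      refine ⟨a * u + d * b * v, a * v + b * u, ?_⟩
      simp only [map_add, map_mul]
      linear_combination (algebraMap ℚ L b * algebraMap ℚ L v) * hα
  indep a b hab := by
    have hab : algebraMap ℚ L a + algebraMap ℚ L b * α = 0 := by
      simpa using congrArg (algebraMap ℚ⟮α⟯ L) hab
    have hsq : a ^ 2 = d * b ^ 2 := by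
      apply (algebraMap ℚ L).injective
      simp only [map_mul, map_pow]
      linear_combination
        (algebraMap ℚ L a - algebraMap ℚ L b * α) * hab + algebraMap ℚ L b ^ 2 * hα
    by_cases hb : b = 0
    · subst hb
      simpa using hsq
    · refine absurd ?_ (hd (a / b))
      rw [div_pow, hsq]
      field_simp

theorem Squarefree.exists_intCast_eq_of_mul_sq {d : ℤ} (hd : Squarefree d) {q : ℚ} {k : ℤ}
    (h : d * q ^ 2 = k) : ∃ m : ℤ, q = m := by
  have hden : (q.den : ℚ) ≠ 0 := by exact_mod_cast q.den_ne_zero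
  have h1 : d * q.num ^ 2 = k * (q.den : ℤ) ^ 2 := by
    have : (d : ℚ) * q.num ^ 2 = k * (q.den : ℚ) ^ 2 := by
      rw [← h, ← Rat.mul_den_eq_num q]
      ring
    exact_mod_cast this
  have hcop : IsCoprime ((q.den : ℤ) ^ 2) (q.num ^ 2) :=
    (Int.isCoprime_iff_nat_coprime.mpr (by simpa using q.reduced.symm)).pow
  have hdvd : (q.den : ℤ) * q.den ∣ d := by
    rw [← pow_two]
    exact hcop.dvd_of_dvd_mul_right ⟨k, by rw [h1, mul_comm]⟩
  have hone : q.den = 1 := by simpa using Int.isUnit_iff_natAbs_eq.mp (hd _ hdvd)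
  exact ⟨q.num, (Rat.coe_int_num_of_den_eq_one hone).symm⟩

namespace IsQuadraticGenerator

variable {K : Type*} [Field K] [NumberField K] {θ : K} {d : ℤ}

theorem exists_two_mul_eq (h : IsQuadraticGenerator θ (0 : ℚ) (-d)) (hd : Squarefree d)
    {x : K} (hx : IsIntegral ℤ x) :
    ∃ a b : ℤ, 2 * x = a + b * θ ∧ 4 ∣ a ^ 2 - d * b ^ 2 := by
  obtain ⟨r, s, hrs⟩ := h.exists_eq x
  have hsq : θ ^ 2 = d := by simpa using h.sq
  obtain ⟨a, ha⟩ : ∃ a : ℤ, (a : ℚ) = 2 * r := by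
    have := Algebra.isIntegral_trace (L := ℚ) hx
    rw [hrs, h.trace_eq, mul_zero, add_zero] at this
    simpa using IsIntegrallyClosed.isIntegral_iff.mp this
  obtain ⟨m, hm⟩ : ∃ m : ℤ, (m : ℚ) = r ^ 2 - d * s ^ 2 := by
    have : IsIntegral ℤ (algebraMap ℚ K (r ^ 2 - d * s ^ 2)) := by
      have heq : algebraMap ℚ K (r ^ 2 - d * s ^ 2) = (a : K) * x - x ^ 2 := by
        have haK : (a : K) = 2 * algebraMap ℚ K r := by
          simpa using congrArg (algebraMap ℚ K) ha
        rw [haK, hrs]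
        simp only [map_sub, map_mul, map_pow, map_intCast]
        linear_combination (algebraMap ℚ K s ^ 2) * hsq
      rw [heq]
      exact ((isIntegral_algebraMap (R := ℤ) (A := K) (x := a)).mul hx).sub (hx.pow 2)
    simpa using IsIntegrallyClosed.isIntegral_iff.mp
      ((isIntegral_algebraMap_iff (algebraMap ℚ K).injective).mp this)
  obtain ⟨b, hb⟩ := hd.exists_intCast_eq_of_mul_sq (q := 2 * s) (k := a ^ 2 - 4 * m) (by
    push_cast
    rw [ha, hm]
    ring)
  refine ⟨a, b, ?_, m, ?_⟩
  · have haK : (a : K) = 2 * algebraMap ℚ K r := by simpa using congrArg (algebraMap ℚ K) ha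
    have hbK : 2 * algebraMap ℚ K s = b := by simpa using congrArg (algebraMap ℚ K) hb
    rw [hrs, haK, ← hbK]
    ring
  · have : (a : ℚ) ^ 2 - d * b ^ 2 = 4 * m := by
      rw [ha, hm, ← hb]
      ring
    exact_mod_cast this

theorem intCast_indep (h : IsQuadraticGenerator θ (0 : ℚ) (-d)) {a b : ℤ}
    (hab : (a : K) + b * θ = 0) : a = 0 ∧ b = 0 := by
  simpa using h.indep a b (by simpa using hab)

theorem ringOfIntegers_of_emod_four_eq_three (h : IsQuadraticGenerator θ (0 : ℚ) (-d))
    (hd : Squarefree d) (h4 : d % 4 = 3) :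
    ∃ ω : 𝓞 K, IsQuadraticGenerator ω (0 : ℤ) (-d) := by
  have hsq : θ ^ 2 = d := by simpa using h.sq
  have integral : IsIntegral ℤ θ := .of_pow two_pos (by
    rw [hsq]
    exact isIntegral_algebraMap (R := ℤ) (x := d))
  obtain ⟨ω, rfl⟩ : ∃ ω : 𝓞 K, algebraMap (𝓞 K) K ω = θ := ⟨⟨θ, integral⟩, rfl⟩
  refine ⟨ω, ?_, fun x ↦ ?_, fun a b hab ↦ h.intCast_indep ?_⟩
  · apply RingOfIntegers.coe_injective
    simpa using hsq
  · obtain ⟨a, b, hab, hdvd⟩ := h.exists_two_mul_eq hd x.isIntegral_coe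
    have : 2 ∣ a ∧ 2 ∣ b := by
      have h1 : (a ^ 2 - d * b ^ 2) % 4 = 0 := Int.emod_eq_zero_of_dvd hdvd
      have ha : a % 4 = 0 ∨ a % 4 = 1 ∨ a % 4 = 2 ∨ a % 4 = 3 := by omega
      have hb : b % 4 = 0 ∨ b % 4 = 1 ∨ b % 4 = 2 ∨ b % 4 = 3 := by omega
      rcases ha with ha | ha | ha | ha <;> rcases hb with hb | hb | hb | hb <;>
        first
          | omega
          | simp [Int.sub_emod, Int.mul_emod, pow_two, ha, hb, h4] at h1
    obtain ⟨⟨u, rfl⟩, v, rfl⟩ := this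
    refine ⟨u, v, RingOfIntegers.coe_injective ?_⟩
    apply mul_left_cancel₀ (two_ne_zero (α := K))
    rw [hab]
    simp
    ring
  · simpa using congrArg (algebraMap (𝓞 K) K) hab

theorem ringOfIntegers_of_four_mul_eq (h : IsQuadraticGenerator θ (0 : ℚ) (-d))
    (hd : Squarefree d) {n : ℤ} (h4 : 4 * n = 1 - d) :
    ∃ ω : 𝓞 K, IsQuadraticGenerator ω (1 : ℤ) n := by
  obtain rfl : d = 1 - 4 * n := by omega
  have hsq : θ ^ 2 = 1 - 4 * n := by simpa using h.sq
  have hsq' : ((1 + θ) / 2) ^ 2 = (1 + θ) / 2 - n := by linear_combination hsq / 4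
  have integral : IsIntegral ℤ ((1 + θ) / 2) := by
    refine ⟨X ^ 2 - X + C n, by monicity!, ?_⟩
    simp only [eval₂_add, eval₂_sub, eval₂_X_pow, eval₂_X, eval₂_C, hsq']
    simp
  obtain ⟨ω, hω⟩ : ∃ ω : 𝓞 K, algebraMap (𝓞 K) K ω = (1 + θ) / 2 := ⟨⟨_, integral⟩, rfl⟩
  refine ⟨ω, ?_, fun x ↦ ?_, fun a b hab ↦ ?_⟩
  · apply RingOfIntegers.coe_injective
    simpa [hω] using hsq'
  · obtain ⟨a, b, hab, hdvd⟩ := h.exists_two_mul_eq hd x.isIntegral_coe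
    obtain ⟨u, hu⟩ : 2 ∣ a - b := by
      obtain ⟨k, hk⟩ := hdvd
      have h1 : Even (a ^ 2 - b ^ 2) := ⟨2 * k - 2 * n * b ^ 2, by linarith⟩
      rw [← even_iff_two_dvd]
      simpa [Int.even_sub, Int.even_pow] using h1
    obtain rfl : a = 2 * u + b := by omega
    refine ⟨u, b, RingOfIntegers.coe_injective ?_⟩
    apply mul_left_cancel₀ (two_ne_zero (α := K))
    rw [hab]
    simp [hω]
    ring
  · have hab : (a : K) + b * ((1 + θ) / 2) = 0 := by
      simpa [hω] using congrArg (algebraMap (𝓞 K) K) hab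
    have := h.intCast_indep (a := 2 * a + b) (b := b) (by push_cast; linear_combination 2 * hab)
    omega

theorem discr_eq {ω : 𝓞 K} {t n : ℤ} (h : IsQuadraticGenerator ω t n) :
    discr K = t ^ 2 - 4 * n := by
  rw [← discr_eq_discr K h.basis, h.discr_basis]

theorem finrank_rat_eq {ω : 𝓞 K} {t n : ℤ} (h : IsQuadraticGenerator ω t n) :
    Module.finrank ℚ K = 2 := by
  rw [← RingOfIntegers.rank, h.finrank_eq]

theorem nrComplexPlaces_le_one {ω : 𝓞 K} {t n : ℤ} (h : IsQuadraticGenerator ω t n) :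
    InfinitePlace.nrComplexPlaces K ≤ 1 := by
  have := InfinitePlace.card_add_two_mul_card_eq_rank K
  rw [h.finrank_rat_eq] at this
  omega

theorem nonempty_classGroup_mulEquiv_of_neg91 {ω : 𝓞 K}
    (h : IsQuadraticGenerator ω (0 : ℤ) (-91)) :
    Nonempty (ClassGroup (𝓞 K) ≃* Multiplicative (ZMod 2)) := by
  have hω : ω ^ 2 = 91 := by simpa using h.int_sq
  have hQ : ¬ Submodule.IsPrincipal (Ideal.span {(2 : 𝓞 K), ω - 1}) := by
    rintro ⟨x, hx⟩
    obtain ⟨a, b, rfl⟩ := h.int_exists_eq x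
    rw [Ideal.submodule_span_eq] at hx
    have h2 := h.dvd_normForm (p := 2) (a := 1) (e := a) (f := b) (by norm_num) (by
      simp [hx])
    have h4 := h.normForm_dvd (a := a) (b := b) (c := 2) (d := 0) (by
      rw [← Ideal.mem_span_singleton, ← hx]
      exact Ideal.subset_span (by simp))
    have h90 := h.normForm_dvd (a := a) (b := b) (c := -1) (d := 1) (by
      rw [← Ideal.mem_span_singleton, ← hx]
      exact Ideal.subset_span (by simp [sub_eq_neg_add]))
    norm_num at h2 h4 h90
    have hN : a ^ 2 - 91 * b ^ 2 = 2 ∨ a ^ 2 - 91 * b ^ 2 = -2 := by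
      have hdvd : a ^ 2 - 91 * b ^ 2 ∣ 2 := by
        convert! dvd_sub h90 (h4.mul_left 22) using 1
      have hle := Int.le_of_dvd two_pos hdvd
      have hge := Int.le_of_dvd two_pos (neg_dvd.mpr hdvd)
      have hne : a ^ 2 - 91 * b ^ 2 ≠ 0 := by
        intro h0
        simp [h0] at hdvd
      omega
    have h13 : ∀ a b : ZMod 13, a ^ 2 - 91 * b ^ 2 ≠ 2 ∧ a ^ 2 - 91 * b ^ 2 ≠ -2 := by decide
    rcases hN with hN | hN
    · exact (h13 a b).1 (by exact_mod_cast congrArg (Int.cast : ℤ → ZMod 13) hN)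
    · exact (h13 a b).2 (by exact_mod_cast congrArg (Int.cast : ℤ → ZMod 13) hN)
  have hcomplex : InfinitePlace.nrComplexPlaces K = 0 := by
    have hle := h.nrComplexPlaces_le_one
    have hsign := sign_discr K
    rw [h.discr_eq] at hsign
    interval_cases hr : InfinitePlace.nrComplexPlaces K
    · rfl
    · norm_num at hsign
  refine ClassGroup.nonempty_mulEquiv_zmod_two (fun h0 ↦ hQ (by rw [h0]; exact bot_isPrincipal)) hQ
    ⟨2, Ideal.span_pair_mul_span_pair_eq_span_singleton ⟨2, by ring⟩ ⟨ω - 1, by ring⟩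
      ⟨ω - 1, by ring⟩ ⟨46 - ω, by linear_combination hω⟩
      ⟨-22, 1, 0, 1, by linear_combination hω⟩⟩ 9 ?_ ?_
  · rw [hcomplex, h.finrank_rat_eq, h.discr_eq]
    have : √|((0 ^ 2 - 4 * (-91) : ℤ) : ℝ)| < 20 := by
      rw [Real.sqrt_lt' (by norm_num)]
      norm_num
    norm_num [Nat.factorial] at this ⊢
    linarith
  · intro P p hP hp hp9 hpP
    rcases h.prime_eq hP hp hpP with rfl | ⟨a, hap, hdvd, rfl⟩
    · exact Or.inl ⟨_, rfl⟩
    interval_cases p <;> try (exfalso; revert hp; norm_num; done)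
    all_goals interval_cases a <;> try (exfalso; revert hdvd; norm_num; done)
    all_goals simp only [Nat.cast_ofNat, Nat.cast_one, Nat.cast_zero, sub_zero]
    · exact Or.inr ⟨2, Ideal.span_pair_mul_span_pair_eq_span_singleton
        ⟨2, by ring⟩
        ⟨ω - 1, by ring⟩
        ⟨ω - 1, by ring⟩
        ⟨46 - ω, by linear_combination hω⟩
        ⟨-22, 1, 0, 1, by linear_combination hω⟩⟩
    · exact Or.inl ⟨19 + 2 * ω, Ideal.span_pair_eq_span_singleton
        ⟨2 * ω - 19, by linear_combination (-4) * hω⟩ ⟨67 - 7 * ω, by linear_combination 14 * hω⟩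
        ⟨7, 2, by ring⟩⟩
    · exact Or.inl ⟨19 - 2 * ω, Ideal.span_pair_eq_span_singleton
        ⟨-19 - 2 * ω, by linear_combination (-4) * hω⟩ ⟨-48 - 5 * ω, by linear_combination (-10) * hω⟩
        ⟨5, -2, by ring⟩⟩
    · exact Or.inr ⟨9 + ω, Ideal.span_pair_mul_span_pair_eq_span_singleton
        ⟨ω - 9, by linear_combination (-1) * hω⟩
        ⟨50 - 5 * ω, by linear_combination 5 * hω⟩
        ⟨20 - 2 * ω, by linear_combination 2 * hω⟩
        ⟨11 * ω - 101, by linear_combination (-10) * hω⟩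
        ⟨1, 1, -2, 0, by ring⟩⟩
    · exact Or.inr ⟨9 - ω, Ideal.span_pair_mul_span_pair_eq_span_singleton
        ⟨-9 - ω, by linear_combination (-1) * hω⟩
        ⟨-41 - 4 * ω, by linear_combination (-4) * hω⟩
        ⟨-11 - ω, by linear_combination (-1) * hω⟩
        ⟨-40 - 5 * ω, by linear_combination (-4) * hω⟩
        ⟨2, -1, 2, 0, by ring⟩⟩
    · exact Or.inr ⟨105 + 11 * ω, Ideal.span_pair_mul_span_pair_eq_span_singleton
        ⟨105 - 11 * ω, by linear_combination 121 * hω⟩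
        ⟨58 * ω - 553, by linear_combination (-638) * hω⟩
        ⟨15 * ω - 143, by linear_combination (-165) * hω⟩
        ⟨754 - 79 * ω, by linear_combination 870 * hω⟩
        ⟨8, 1, 2, 0, by ring⟩⟩

theorem nonempty_classGroup_mulEquiv_of_23 {ω : 𝓞 K}
    (h : IsQuadraticGenerator ω (1 : ℤ) 23) :
    Nonempty (ClassGroup (𝓞 K) ≃* Multiplicative (ZMod 2)) := by
  have hω : ω ^ 2 = ω - 23 := by simpa using h.int_sq
  have hQ : ¬ Submodule.IsPrincipal (Ideal.span {(5 : 𝓞 K), ω - 2}) := by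
    rintro ⟨x, hx⟩
    obtain ⟨a, b, rfl⟩ := h.int_exists_eq x
    rw [Ideal.submodule_span_eq] at hx
    have h5 := h.dvd_normForm (p := 5) (a := 2) (e := a) (f := b) (by norm_num) (by
      simp [hx])
    have h25 := h.normForm_dvd (a := a) (b := b) (c := 5) (d := 0) (by
      rw [← Ideal.mem_span_singleton, ← hx]
      exact Ideal.subset_span (by simp))
    have h35 := h.normForm_dvd (a := a) (b := b) (c := 3) (d := 1) (by
      rw [← Ideal.mem_span_singleton, ← hx, Ideal.mem_span_pair]
      exact ⟨1, 1, by push_cast; ring⟩)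
    norm_num at h5 h25 h35
    have hdvd : a ^ 2 + a * b + 23 * b ^ 2 ∣ 5 := by
      convert! dvd_sub (h25.mul_left 3) (h35.mul_left 2) using 1
    have hle := Int.le_of_dvd (by norm_num) hdvd
    have hb : b = 0 := by
      have : b ^ 2 < 1 := by nlinarith [sq_nonneg (2 * a + b)]
      nlinarith
    subst hb
    have ha : a < 3 ∧ -3 < a := by constructor <;> nlinarith
    obtain ⟨ha, ha'⟩ := ha
    interval_cases a <;> omega
  refine ClassGroup.nonempty_mulEquiv_zmod_two (fun h0 ↦ hQ (by rw [h0]; exact bot_isPrincipal)) hQ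
    ⟨ω - 2, Ideal.span_pair_mul_span_pair_eq_span_singleton
      ⟨-1 - ω, by linear_combination hω⟩ ⟨5, by ring⟩ ⟨5, by ring⟩ ⟨ω - 2, by ring⟩
      ⟨3, 2, 0, 3, by linear_combination 3 * hω⟩⟩ 6 ?_ ?_
  · have hpi : 4 / Real.pi < 4 / 3.14 :=
      div_lt_div_of_pos_left (by norm_num) (by norm_num) Real.pi_gt_d2
    have hpow : (4 / Real.pi) ^ InfinitePlace.nrComplexPlaces K ≤ 4 / 3.14 := by
      have hle := h.nrComplexPlaces_le_one
      interval_cases InfinitePlace.nrComplexPlaces K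
      · norm_num
      · rw [pow_one]
        exact hpi.le
    rw [h.finrank_rat_eq, h.discr_eq]
    have hsqrt : √|((1 ^ 2 - 4 * 23 : ℤ) : ℝ)| < 10 := by
      rw [Real.sqrt_lt' (by norm_num)]
      norm_num
    calc _ ≤ 4 / 3.14 * (((2).factorial : ℝ) / (2 : ℕ) ^ 2 * 10) := by gcongr
      _ < _ := by norm_num [Nat.factorial]
  · intro P p hP hp hp6 hpP
    rcases h.prime_eq hP hp hpP with rfl | ⟨a, hap, hdvd, rfl⟩
    · exact Or.inl ⟨_, rfl⟩
    interval_cases p <;> try (exfalso; revert hp; norm_num; done)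
    all_goals interval_cases a <;> try (exfalso; revert hdvd; norm_num; done)
    all_goals simp only [Nat.cast_ofNat]
    · exact Or.inr ⟨ω - 2, Ideal.span_pair_mul_span_pair_eq_span_singleton
        ⟨-1 - ω, by linear_combination hω⟩ ⟨5, by ring⟩ ⟨5, by ring⟩ ⟨ω - 2, by ring⟩
        ⟨3, 2, 0, 3, by linear_combination 3 * hω⟩⟩
    · exact Or.inr ⟨5, Ideal.span_pair_mul_span_pair_eq_span_singleton
        ⟨5, by ring⟩ ⟨ω - 2, by ring⟩ ⟨ω - 4, by ring⟩ ⟨-3 - ω, by linear_combination hω⟩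
        ⟨1, -2, 2, 0, by ring⟩⟩

end IsQuadraticGenerator

end QuadraticField

/-- The ideal class group of the ring of integers of `ℚ(√91)` is isomorphic to
`ℤ/2ℤ`, and the ideal class group of the ring of integers of `ℚ(√-91)` is also
isomorphic to `ℤ/2ℤ`. -/
theorem classGroup_sqrt91_and_sqrt_neg91 :
    Nonempty (ClassGroup (𝓞 ℚ⟮Real.sqrt (91 : ℕ)⟯) ≃* Multiplicative (ZMod 2)) ∧
    Nonempty (ClassGroup (𝓞 ℚ⟮(Real.sqrt (91 : ℕ) : ℂ) * Complex.I⟯) ≃*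
      Multiplicative (ZMod 2)) := by
  have hsqf : Squarefree (91 : ℤ) := by
    rw [← Int.squarefree_natAbs]
    exact (Nat.squarefree_mul (m := 7) (n := 13) (by norm_num)).mpr
      ⟨Nat.Prime.prime (by norm_num) |>.squarefree, Nat.Prime.prime (by norm_num) |>.squarefree⟩
  have hsqf' : Squarefree (-91 : ℤ) := by rwa [← Int.squarefree_natAbs] at hsqf ⊢
  have hsqrt : √((91 : ℕ) : ℝ) ^ 2 = 91 := by rw [Real.sq_sqrt (by positivity)]; norm_num
  constructor
  · have hgen := isQuadraticGenerator_gen (α := √((91 : ℕ) : ℝ)) (d := ((91 : ℤ) : ℚ))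
      (by rw [hsqrt]; simp) (fun q hq ↦ by
        obtain ⟨m, hm⟩ := Squarefree.exists_intCast_eq_of_mul_sq squarefree_one (q := q) (k := 91)
          (by rw [hq]; simp)
        rw [hm] at hq
        have hq : m ^ 2 = 91 := by exact_mod_cast hq
        have : m < 10 := by nlinarith
        have : -10 < m := by nlinarith
        interval_cases m <;> omega)
    obtain ⟨ω, hω⟩ := hgen.ringOfIntegers_of_emod_four_eq_three hsqf (by norm_num)
    exact hω.nonempty_classGroup_mulEquiv_of_neg91
  · have hgen := isQuadraticGenerator_gen (α := (√((91 : ℕ) : ℝ) : ℂ) * Complex.I)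
      (d := ((-91 : ℤ) : ℚ))
      (by rw [mul_pow, Complex.I_sq, ← Complex.ofReal_pow, hsqrt]; simp)
      (fun q hq ↦ by
        have := sq_nonneg q
        rw [hq] at this
        norm_num at this)
    obtain ⟨ω, hω⟩ := hgen.ringOfIntegers_of_four_mul_eq hsqf' (n := 23) (by norm_num)
    exact hω.nonempty_classGroup_mulEquiv_of_23
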